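/- arXiv:2511.09393 — 2 statements merged into one kernel-verified Lean document; each statement's English description precedes it below -/
import Mathlib

section
/- Every bounded biharmonic function on ℝⁿ is constant; that is, if u : ℝⁿ → ℝ is smooth, Δ²u = 0, and |u(x)| ≤ C for all x, then u is constant. -/
open MeasureTheory

/-- The Laplacian of `u : ℝⁿ → ℝ`, `Δu = ∑ i ∂²u/∂xᵢ²`. -/
noncomputable def lap {n : ℕ} (u : EuclideanSpace ℝ (Fin n) → ℝ)
    (x : EuclideanSpace ℝ (Fin n)) : ℝ :=
  ∑ i : Fin n, fderiv ℝ (fun y => fderiv ℝ u y (EuclideanSpace.single i 1)) x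
    (EuclideanSpace.single i 1)


/-- The radial kernel `(1 - ‖y‖²)₊ ^ k`. -/
noncomputable def ballKernel {n : ℕ} (k : ℕ) (y : EuclideanSpace ℝ (Fin n)) : ℝ :=
  (max 0 (1 - ‖y‖ ^ 2)) ^ k

/-- The unnormalised average of `u` over the ball of center `x` and radius `r`, weighted by
`ballKernel k`. -/
noncomputable def ballAverage {n : ℕ} (k : ℕ) (u : EuclideanSpace ℝ (Fin n) → ℝ)
    (x : EuclideanSpace ℝ (Fin n)) (r : ℝ) : ℝ :=
  ∫ y, u (x + r • y) * ballKernel k y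

section

variable {n : ℕ} {k : ℕ} {u : EuclideanSpace ℝ (Fin n) → ℝ}

lemma hasDerivAt_max_zero_pow (k : ℕ) (t : ℝ) :
    HasDerivAt (fun s : ℝ => (max 0 s) ^ (k + 2)) ((k + 2) * (max 0 t) ^ (k + 1)) t := by
  rcases lt_trichotomy t 0 with ht | rfl | ht
  · rw [max_eq_left ht.le]
    have h : (fun s : ℝ => (max 0 s) ^ (k + 2)) =ᶠ[nhds t] fun _ => (0 : ℝ) := by
      filter_upwards [Iio_mem_nhds ht] with s hs
      rw [max_eq_left (le_of_lt hs)]; simp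
    simpa using (hasDerivAt_const t (0 : ℝ)).congr_of_eventuallyEq h
  · rw [hasDerivAt_iff_tendsto_slope]
    have hc : Filter.Tendsto (fun s : ℝ => (max 0 s) ^ (k + 1)) (nhdsWithin 0 {0}ᶜ)
        (nhds ((max 0 (0 : ℝ)) ^ (k + 1))) :=
      (Continuous.tendsto (by fun_prop) 0).mono_left nhdsWithin_le_nhds
    simp only [max_self, ne_eq, Nat.succ_ne_zero, not_false_eq_true, zero_pow, mul_zero] at hc ⊢
    refine hc.congr' ?_
    filter_upwards [self_mem_nhdsWithin] with s hs
    have hs : s ≠ 0 := hs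
    rcases le_total s 0 with h | h
    · simp [slope_def_field, max_eq_left h]
    · simp [slope_def_field, max_eq_right h]
      field_simp
      ring
  · rw [max_eq_right ht.le]
    have h : (fun s : ℝ => (max 0 s) ^ (k + 2)) =ᶠ[nhds t] fun s => s ^ (k + 2) := by
      filter_upwards [Ioi_mem_nhds ht] with s hs
      rw [max_eq_right (le_of_lt hs)]
    simpa using (hasDerivAt_pow (k + 2) t).congr_of_eventuallyEq h

lemma continuous_ballKernel (k : ℕ) :
    Continuous (ballKernel k : EuclideanSpace ℝ (Fin n) → ℝ) := by
  unfold ballKernel; fun_prop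

lemma ballKernel_nonneg (k : ℕ) (y : EuclideanSpace ℝ (Fin n)) : 0 ≤ ballKernel k y :=
  pow_nonneg (le_max_left _ _) _

lemma ballKernel_le_one (k : ℕ) (y : EuclideanSpace ℝ (Fin n)) : ballKernel k y ≤ 1 :=
  pow_le_one₀ (le_max_left _ _) (max_le zero_le_one (by nlinarith [sq_nonneg ‖y‖]))

lemma ballKernel_eq_zero (hk : k ≠ 0) {y : EuclideanSpace ℝ (Fin n)} (hy : 1 ≤ ‖y‖) :
    ballKernel k y = 0 := by
  rw [ballKernel, max_eq_left (by nlinarith), zero_pow hk]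

lemma hasCompactSupport_ballKernel (hk : k ≠ 0) :
    HasCompactSupport (ballKernel k : EuclideanSpace ℝ (Fin n) → ℝ) :=
  HasCompactSupport.intro (isCompact_closedBall 0 1) fun y hy =>
    ballKernel_eq_zero hk (by simpa using (not_le.mp (by simpa using hy)).le)

lemma integrable_mul_ballKernel (hk : k ≠ 0) {f : EuclideanSpace ℝ (Fin n) → ℝ}
    (hf : Continuous f) : Integrable (fun y => f y * ballKernel k y) :=
  (hf.mul (continuous_ballKernel k)).integrable_of_hasCompactSupport
    (hasCompactSupport_ballKernel hk).mul_left

lemma integral_ballKernel_pos (hk : k ≠ 0) :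
    0 < ∫ y : EuclideanSpace ℝ (Fin n), ballKernel k y :=
  (continuous_ballKernel k).integral_pos_of_hasCompactSupport_nonneg_nonzero
    (hasCompactSupport_ballKernel hk) (ballKernel_nonneg k) (x := 0) (by simp [ballKernel])

lemma hasFDerivAt_ballKernel (k : ℕ) (y : EuclideanSpace ℝ (Fin n)) :
    HasFDerivAt (ballKernel (k + 2)) ((-2 * (k + 2) * ballKernel (k + 1) y) • innerSL ℝ y) y := by
  have h1 : HasFDerivAt (fun y : EuclideanSpace ℝ (Fin n) => 1 - ‖y‖ ^ 2)
      (-(2 • innerSL ℝ y)) y := (hasStrictFDerivAt_norm_sq y).hasFDerivAt.const_sub 1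
  have h2 := (hasDerivAt_max_zero_pow k (1 - ‖y‖ ^ 2)).comp_hasFDerivAt y h1
  refine h2.congr_fderiv ?_
  ext z
  simp [ballKernel]
  ring

lemma ballAverage_zero (k : ℕ) (u : EuclideanSpace ℝ (Fin n) → ℝ)
    (x : EuclideanSpace ℝ (Fin n)) :
    ballAverage k u x 0 = u x * ∫ y : EuclideanSpace ℝ (Fin n), ballKernel k y := by
  simp [ballAverage, integral_const_mul]

lemma hasDerivAt_ballAverage_aux (hk : k ≠ 0) (hu : ContDiff ℝ 1 u)
    (x : EuclideanSpace ℝ (Fin n)) (r : ℝ) :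
    HasDerivAt (ballAverage k u x) (∫ y, fderiv ℝ u (x + r • y) y * ballKernel k y) r := by
  have hc : Continuous (fderiv ℝ u) := hu.continuous_fderiv one_ne_zero
  have hK := continuous_ballKernel (n := n) k
  have hu0 := hu.continuous
  obtain ⟨M, hM⟩ := ((isCompact_closedBall r 1).prod
    (isCompact_closedBall (0 : EuclideanSpace ℝ (Fin n)) 1)).exists_bound_of_continuousOn
    (f := fun p : ℝ × EuclideanSpace ℝ (Fin n) =>
      fderiv ℝ u (x + p.1 • p.2) p.2 * ballKernel k p.2) (by fun_prop)
  refine (hasDerivAt_integral_of_dominated_loc_of_deriv_le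
    (F := fun r y => u (x + r • y) * ballKernel k y)
    (F' := fun r y => fderiv ℝ u (x + r • y) y * ballKernel k y)
    (bound := (Metric.closedBall (0 : EuclideanSpace ℝ (Fin n)) 1).indicator fun _ => M)
    (Metric.closedBall_mem_nhds r one_pos) ?_ ?_ ?_ ?_ ?_ ?_).2
  · exact .of_forall fun r =>
      (Continuous.aestronglyMeasurable (by fun_prop))
  · exact integrable_mul_ballKernel (f := fun y => u (x + r • y)) hk (by fun_prop)
  · exact (Continuous.aestronglyMeasurable (by fun_prop))
  · refine .of_forall fun y s hs => ?_
    by_cases hy : y ∈ Metric.closedBall (0 : EuclideanSpace ℝ (Fin n)) 1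
    · rw [Set.indicator_of_mem hy]
      exact hM (s, y) ⟨hs, hy⟩
    · rw [Set.indicator_of_notMem hy, ballKernel_eq_zero hk]
      · simp
      · simpa using (not_le.mp (by simpa using hy)).le
  · exact (integrableOn_const (measure_closedBall_lt_top.ne)).integrable_indicator
      measurableSet_closedBall
  · refine .of_forall fun y s _ => HasDerivAt.mul_const ?_ _
    have h1 : HasDerivAt (fun s : ℝ => x + s • y) y s := by
      simpa using ((hasDerivAt_id s).smul_const y).const_add x
    exact ((hu.differentiable one_ne_zero _).hasFDerivAt).comp_hasDerivAt s h1

lemma ContDiff.fderiv_single (hu : ContDiff ℝ 2 u) (i : Fin n) :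
    ContDiff ℝ 1 fun y => fderiv ℝ u y (EuclideanSpace.single i 1) :=
  (hu.fderiv_right (m := 1) (by norm_num)).clm_apply contDiff_const

lemma ContDiff.continuous_lap_summand (hu : ContDiff ℝ 2 u) (i : Fin n) :
    Continuous fun x => fderiv ℝ (fun y => fderiv ℝ u y (EuclideanSpace.single i 1)) x
      (EuclideanSpace.single i 1) :=
  ((hu.fderiv_single i).continuous_fderiv one_ne_zero).clm_apply continuous_const

lemma integral_fderiv_mul_ballKernel (hu : ContDiff ℝ 2 u)
    (x : EuclideanSpace ℝ (Fin n)) (r : ℝ) :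
    ∫ y, fderiv ℝ u (x + r • y) y * ballKernel (k + 1) y =
      r / (2 * (k + 2)) * ballAverage (k + 2) (lap u) x r := by
  have key (i : Fin n) : ∫ y, fderiv ℝ u (x + r • y) (EuclideanSpace.single i 1) *
        (y i * ballKernel (k + 1) y) =
      r / (2 * (k + 2)) * ∫ y, fderiv ℝ (fun y => fderiv ℝ u y (EuclideanSpace.single i 1))
        (x + r • y) (EuclideanSpace.single i 1) * ballKernel (k + 2) y := by
    set g := fun y => fderiv ℝ u y (EuclideanSpace.single i 1) with hg
    have hg1 : ContDiff ℝ 1 g := hu.fderiv_single i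
    have hgc : Continuous g := hg1.continuous
    have hg' : Continuous (fun y => fderiv ℝ g y (EuclideanSpace.single i 1)) :=
      hu.continuous_lap_summand i
    have hd (y : EuclideanSpace ℝ (Fin n)) :
        HasFDerivAt (fun y => g (x + r • y)) (r • fderiv ℝ g (x + r • y)) y := by
      have h1 : HasFDerivAt (fun y : EuclideanSpace ℝ (Fin n) => x + r • y)
          (r • ContinuousLinearMap.id ℝ _) y := ((hasFDerivAt_id y).const_smul r).const_add x
      refine ((hg1.differentiable one_ne_zero _).hasFDerivAt.comp y h1).congr_fderiv ?_
      ext z; simp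
    have hf1 (y : EuclideanSpace ℝ (Fin n)) :
        fderiv ℝ (ballKernel (k + 2)) y (EuclideanSpace.single i 1) =
          -2 * (k + 2) * (y i * ballKernel (k + 1) y) := by
      rw [(hasFDerivAt_ballKernel k y).fderiv]
      simp [EuclideanSpace.inner_single_right]
      ring
    have hf2 (y : EuclideanSpace ℝ (Fin n)) :
        fderiv ℝ (fun y => g (x + r • y)) y (EuclideanSpace.single i 1) =
          r * fderiv ℝ g (x + r • y) (EuclideanSpace.single i 1) := by
      rw [(hd y).fderiv]; simp
    have hparts := integral_mul_fderiv_eq_neg_fderiv_mul_of_integrable (μ := volume)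
      (f := fun y => g (x + r • y)) (g := ballKernel (k + 2)) (v := EuclideanSpace.single i 1)
      ?_ ?_ ?_ (fun y _ => (hd y).differentiableAt)
      (fun y _ => (hasFDerivAt_ballKernel k y).differentiableAt)
    · simp only [hf1, hf2] at hparts
      have e1 : ∀ y, g (x + r • y) * (-2 * (k + 2) * (y i * ballKernel (k + 1) y)) =
        (-2 * (k + 2)) * (g (x + r • y) * (y i * ballKernel (k + 1) y)) := fun y => by ring
      simp only [e1, mul_assoc r, integral_const_mul] at hparts
      change ∫ y, g (x + r • y) * (y i * ballKernel (k + 1) y) = _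
      rw [div_mul_eq_mul_div, eq_div_iff (by positivity)]
      linarith
    · simp only [hf2]
      exact integrable_mul_ballKernel (by simp) (by fun_prop)
    · simp only [hf1]
      have e1 : ∀ y, g (x + r • y) * (-2 * (k + 2) * (y i * ballKernel (k + 1) y)) =
        (-2 * (k + 2) * g (x + r • y) * y i) * ballKernel (k + 1) y := fun y => by ring
      simp only [e1]
      exact integrable_mul_ballKernel (by simp) (by fun_prop)
    · exact integrable_mul_ballKernel (by simp) (by fun_prop)
  have hsum (y : EuclideanSpace ℝ (Fin n)) : fderiv ℝ u (x + r • y) y * ballKernel (k + 1) y =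
      ∑ i, fderiv ℝ u (x + r • y) (EuclideanSpace.single i 1) *
        (y i * ballKernel (k + 1) y) := by
    have hy : y = ∑ i, y i • EuclideanSpace.single i (1 : ℝ) := by
      simpa using ((EuclideanSpace.basisFun (Fin n) ℝ).sum_repr y).symm
    conv_lhs => enter [1, 2]; rw [hy]
    rw [map_sum, Finset.sum_mul]
    refine Finset.sum_congr rfl fun i _ => ?_
    rw [map_smul, smul_eq_mul]; ring
  simp only [hsum, ballAverage, lap, Finset.sum_mul]
  rw [integral_finsetSum, integral_finsetSum, Finset.mul_sum]
  · exact Finset.sum_congr rfl fun i _ => key i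
  · intro i _
    have := hu.continuous_lap_summand i
    exact integrable_mul_ballKernel (by simp) (by fun_prop)
  · intro i _
    have := (hu.fderiv_single i).continuous
    simp only [← mul_assoc]
    exact integrable_mul_ballKernel (by simp) (by fun_prop)

lemma hasDerivAt_ballAverage (k : ℕ) (hu : ContDiff ℝ 2 u)
    (x : EuclideanSpace ℝ (Fin n)) (r : ℝ) :
    HasDerivAt (ballAverage (k + 1) u x)
      (r / (2 * (k + 2)) * ballAverage (k + 2) (lap u) x r) r := by
  rw [← integral_fderiv_mul_ballKernel hu]
  exact hasDerivAt_ballAverage_aux (by simp) (hu.of_le (by norm_num)) x r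

/-- The weighted mean value property of harmonic functions. -/
lemma ballAverage_eq_of_lap_eq_zero (k : ℕ) (hu : ContDiff ℝ 2 u) (h : ∀ x, lap u x = 0)
    (x : EuclideanSpace ℝ (Fin n)) (r : ℝ) :
    ballAverage (k + 1) u x r = u x * ∫ y : EuclideanSpace ℝ (Fin n), ballKernel (k + 1) y := by
  have hd (s : ℝ) : HasDerivAt (ballAverage (k + 1) u x) 0 s := by
    simpa [ballAverage, h] using hasDerivAt_ballAverage k hu x s
  rw [← ballAverage_zero]
  exact is_const_of_deriv_eq_zero (fun s => (hd s).differentiableAt) (fun s => (hd s).deriv) r 0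

/-- The weighted mean value expansion of biharmonic functions. -/
lemma ballAverage_eq_of_lap_lap_eq_zero (k : ℕ) (hu : ContDiff ℝ 2 u)
    (hu' : ContDiff ℝ 2 (lap u)) (h : ∀ x, lap (lap u) x = 0)
    (x : EuclideanSpace ℝ (Fin n)) (r : ℝ) :
    ballAverage (k + 1) u x r = u x * (∫ y : EuclideanSpace ℝ (Fin n), ballKernel (k + 1) y) +
      r ^ 2 / (4 * (k + 2)) *
        (lap u x * ∫ y : EuclideanSpace ℝ (Fin n), ballKernel (k + 2) y) := by
  set B := lap u x * ∫ y : EuclideanSpace ℝ (Fin n), ballKernel (k + 2) y with hB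
  have hd (s : ℝ) : HasDerivAt
      (fun s => ballAverage (k + 1) u x s - s ^ 2 / (4 * (k + 2)) * B) 0 s := by
    have h1 := hasDerivAt_ballAverage k hu x s
    rw [ballAverage_eq_of_lap_eq_zero (k + 1) hu' h, ← hB] at h1
    have h2 := ((hasDerivAt_pow 2 s).div_const (4 * ((k : ℝ) + 2))).mul_const B
    refine (h1.sub h2).congr_deriv ?_
    have : (k : ℝ) + 2 ≠ 0 := by positivity
    field_simp
    norm_num
    exact .inr (by ring)
  have := is_const_of_deriv_eq_zero (fun s => (hd s).differentiableAt) (fun s => (hd s).deriv) r 0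
  rw [← ballAverage_zero]
  simp only [ne_eq, OfNat.ofNat_ne_zero, not_false_eq_true, zero_pow, zero_div, zero_mul,
    sub_zero] at this
  linarith

lemma abs_ballAverage_le (hk : k ≠ 0) {C : ℝ} (hbd : ∀ x, |u x| ≤ C)
    (x : EuclideanSpace ℝ (Fin n)) (r : ℝ) :
    |ballAverage k u x r| ≤ C * ∫ y : EuclideanSpace ℝ (Fin n), ballKernel k y := by
  rw [← integral_const_mul, ← Real.norm_eq_abs]
  refine norm_integral_le_of_norm_le (integrable_mul_ballKernel hk continuous_const) ?_
  refine .of_forall fun y => ?_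
  rw [norm_mul, Real.norm_eq_abs, Real.norm_of_nonneg (ballKernel_nonneg k y)]
  exact mul_le_mul_of_nonneg_right (hbd _) (ballKernel_nonneg k y)

lemma lap_eq_zero_of_bounded_of_lap_lap_eq_zero (hu : ContDiff ℝ 2 u)
    (hu' : ContDiff ℝ 2 (lap u)) (h : ∀ x, lap (lap u) x = 0) {C : ℝ} (hbd : ∀ x, |u x| ≤ C)
    (x : EuclideanSpace ℝ (Fin n)) : lap u x = 0 := by
  by_contra hne
  set I := ∫ y : EuclideanSpace ℝ (Fin n), ballKernel 1 y
  set J := ∫ y : EuclideanSpace ℝ (Fin n), ballKernel 2 y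
  have hJ : 0 < J := integral_ballKernel_pos two_ne_zero
  have hpos : 0 < |lap u x| * J := mul_pos (abs_pos.mpr hne) hJ
  have hb (r : ℝ) : r ^ 2 / 8 * (|lap u x| * J) ≤ C * I + |u x * I| := by
    have h1 := ballAverage_eq_of_lap_lap_eq_zero 0 hu hu' h x r
    have h2 := abs_ballAverage_le one_ne_zero hbd x r
    have h3 : r ^ 2 / 8 * (lap u x * J) = ballAverage 1 u x r - u x * I := by
      rw [h1]; norm_num; ring
    calc r ^ 2 / 8 * (|lap u x| * J) = |r ^ 2 / 8 * (lap u x * J)| := by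
          rw [abs_mul, abs_mul, abs_of_pos hJ, abs_of_nonneg (by positivity : 0 ≤ r ^ 2 / 8)]
      _ = |ballAverage 1 u x r - u x * I| := by rw [h3]
      _ ≤ |ballAverage 1 u x r| + |u x * I| := abs_sub _ _
      _ ≤ _ := by gcongr
  have ht : Filter.Tendsto (fun r : ℝ => r ^ 2 / 8 * (|lap u x| * J)) Filter.atTop Filter.atTop :=
    ((Filter.tendsto_pow_atTop two_ne_zero).atTop_div_const (by norm_num)).atTop_mul_const hpos
  obtain ⟨r, hr⟩ := (ht.eventually_gt_atTop (C * I + |u x * I|)).exists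
  exact absurd (hb r) (not_le.mpr hr)

lemma tendsto_integral_abs_ballKernel_sub (hk : k ≠ 0) (h : EuclideanSpace ℝ (Fin n)) :
    Filter.Tendsto (fun t : ℝ => ∫ y, |ballKernel k (y - t • h) - ballKernel k y|)
      (nhds 0) (nhds 0) := by
  have hK := continuous_ballKernel (n := n) k
  have hz : (0 : ℝ) = ∫ y : EuclideanSpace ℝ (Fin n),
      |ballKernel k (y - (0 : ℝ) • h) - ballKernel k y| := by simp
  conv => enter [3]; rw [hz]
  refine tendsto_integral_filter_of_dominated_convergence
    ((Metric.closedBall (0 : EuclideanSpace ℝ (Fin n)) 2).indicator fun _ => 1) ?_ ?_ ?_ ?_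
  · exact .of_forall fun t => Continuous.aestronglyMeasurable (by fun_prop)
  · have hc : Filter.Tendsto (fun t : ℝ => ‖t • h‖) (nhds 0) (nhds 0) := by
      have : Continuous fun t : ℝ => ‖t • h‖ := by fun_prop
      simpa using this.tendsto 0
    filter_upwards [hc.eventually_lt_const one_pos] with t ht
    refine .of_forall fun y => ?_
    rw [norm_abs_eq_norm, Real.norm_eq_abs]
    by_cases hy : y ∈ Metric.closedBall (0 : EuclideanSpace ℝ (Fin n)) 2
    · rw [Set.indicator_of_mem hy, abs_le]
      constructor <;> linarith [ballKernel_nonneg k y, ballKernel_le_one k y,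
        ballKernel_nonneg k (y - t • h), ballKernel_le_one k (y - t • h)]
    · have hy2 : 2 < ‖y‖ := by simpa using hy
      have := norm_sub_norm_le y (t • h)
      rw [Set.indicator_of_notMem hy, ballKernel_eq_zero hk (by linarith),
        ballKernel_eq_zero hk (by linarith)]
      simp
  · exact (integrableOn_const (measure_closedBall_lt_top.ne)).integrable_indicator
      measurableSet_closedBall
  · refine .of_forall fun y => Continuous.tendsto ?_ 0
    fun_prop

lemma abs_ballAverage_sub_le (hk : k ≠ 0) (hu : Continuous u) {C : ℝ} (hbd : ∀ x, |u x| ≤ C)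
    (x h : EuclideanSpace ℝ (Fin n)) {t : ℝ} (ht : t ≠ 0) :
    |ballAverage k u (x + h) t⁻¹ - ballAverage k u x t⁻¹| ≤
      C * ∫ y, |ballKernel k (y - t • h) - ballKernel k y| := by
  have hK := continuous_ballKernel (n := n) k
  have hshift : ballAverage k u (x + h) t⁻¹ =
      ∫ y, u (x + t⁻¹ • y) * ballKernel k (y - t • h) := by
    rw [ballAverage, ← integral_sub_right_eq_self _ (t • h)]
    congr 1 with y
    congr 2
    rw [smul_sub, inv_smul_smul₀ ht]
    abel
  have hs : HasCompactSupport fun y : EuclideanSpace ℝ (Fin n) => ballKernel k (y - t • h) :=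
    (hasCompactSupport_ballKernel hk).comp_homeomorph (Homeomorph.subRight (t • h))
  have hi : Integrable fun y : EuclideanSpace ℝ (Fin n) => ballKernel k (y - t • h) :=
    Continuous.integrable_of_hasCompactSupport (by fun_prop) hs
  have hj : Integrable (ballKernel k : EuclideanSpace ℝ (Fin n) → ℝ) :=
    hK.integrable_of_hasCompactSupport (hasCompactSupport_ballKernel hk)
  rw [hshift, ballAverage, ← integral_sub, ← integral_const_mul, ← Real.norm_eq_abs]
  · refine norm_integral_le_of_norm_le ((hi.sub hj).abs.const_mul C) (.of_forall fun y => ?_)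
    rw [← mul_sub, norm_mul, Real.norm_eq_abs, Real.norm_eq_abs]
    exact mul_le_mul_of_nonneg_right (hbd _) (abs_nonneg _)
  · exact Continuous.integrable_of_hasCompactSupport (by fun_prop) hs.mul_left
  · exact integrable_mul_ballKernel hk (by fun_prop)

/-- **Liouville's theorem** for bounded harmonic functions on `ℝⁿ`. -/
lemma eq_of_bounded_of_lap_eq_zero (hu : ContDiff ℝ 2 u) (h : ∀ x, lap u x = 0) {C : ℝ}
    (hbd : ∀ x, |u x| ≤ C) (x y : EuclideanSpace ℝ (Fin n)) : u x = u y := by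
  have hI := integral_ballKernel_pos (n := n) one_ne_zero
  have hmean : ∀ z r, ballAverage 1 u z r =
      u z * ∫ y : EuclideanSpace ℝ (Fin n), ballKernel 1 y :=
    ballAverage_eq_of_lap_eq_zero 0 hu h
  have hle : ∀ᶠ t : ℝ in nhdsWithin 0 {0}ᶜ,
      |(u x - u y) * ∫ z : EuclideanSpace ℝ (Fin n), ballKernel 1 z| ≤
        C * ∫ z, |ballKernel 1 (z - t • (x - y)) - ballKernel 1 z| := by
    filter_upwards [self_mem_nhdsWithin] with t ht
    have := abs_ballAverage_sub_le one_ne_zero hu.continuous hbd y (x - y) ht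
    rwa [hmean, hmean, add_sub_cancel, ← sub_mul] at this
  have hlim := ((tendsto_integral_abs_ballKernel_sub one_ne_zero (x - y)).const_mul C).mono_left
    (nhdsWithin_le_nhds (s := {0}ᶜ))
  have h0 := ge_of_tendsto hlim hle
  rw [mul_zero] at h0
  have := (mul_eq_zero.mp (abs_nonpos_iff.mp h0)).resolve_right hI.ne'
  exact sub_eq_zero.mp this

lemma ContDiff.lap (hu : ContDiff ℝ (⊤ : ℕ∞) u) : ContDiff ℝ (⊤ : ℕ∞) (lap u) := by
  have hd {f : EuclideanSpace ℝ (Fin n) → ℝ} (hf : ContDiff ℝ (⊤ : ℕ∞) f)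
      (v : EuclideanSpace ℝ (Fin n)) : ContDiff ℝ (⊤ : ℕ∞) fun y => fderiv ℝ f y v :=
    (hf.fderiv_right (m := (⊤ : ℕ∞)) (by simp)).clm_apply contDiff_const
  exact ContDiff.sum fun i _ => hd (hd hu _) _

end

/-- Every bounded biharmonic function on ℝⁿ is constant. -/
theorem bounded_biharmonic_constant {n : ℕ} (u : EuclideanSpace ℝ (Fin n) → ℝ)
    (hu : ContDiff ℝ (⊤ : ℕ∞) u)
    (hbih : ∀ x, lap (lap u) x = 0)
    (C : ℝ) (hC : 0 < C) (hbd : ∀ x, |u x| ≤ C) :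
    ∀ x y, u x = u y := by
  have hu2 : ContDiff ℝ 2 u := contDiff_infty.1 hu 2
  have hl2 : ContDiff ℝ 2 (lap u) := contDiff_infty.1 hu.lap 2
  exact eq_of_bounded_of_lap_eq_zero hu2
    (lap_eq_zero_of_bounded_of_lap_lap_eq_zero hu2 hl2 hbih hbd) hbd
end

section
/- For 0 ≤ d < 1, the space of biharmonic functions on ℝⁿ with polynomial growth of rate d is exactly the constant functions, hence has dimension 1. -/
open MeasureTheory

open Filter Topology

section RadialKernel

variable {n : ℕ}

local notation "𝔼" => EuclideanSpace ℝ (Fin n)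

lemma hasCompactSupport_of_zero_outside_unitBall {K : 𝔼 → ℝ} (hK : ∀ y, 1 ≤ ‖y‖ → K y = 0) :
    HasCompactSupport K :=
  HasCompactSupport.intro (isCompact_closedBall (0 : 𝔼) 1) fun y hy =>
    hK y (by simpa using (not_le.1 (fun h => hy (by simpa using h))).le)

lemma radial_zero_outside_unitBall {k : ℝ → ℝ} (hk : ∀ s, 1 ≤ s → k s = 0) (y : 𝔼)
    (hy : 1 ≤ ‖y‖) : k (‖y‖ ^ 2) = 0 :=
  hk _ (one_le_pow₀ hy)

/-- Differentiation of a kernel average with respect to the dilation parameter. -/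
lemma hasDerivAt_integral_dilation {v K : 𝔼 → ℝ} (hv : ContDiff ℝ 1 v) (hKc : Continuous K)
    (hK : ∀ y, 1 ≤ ‖y‖ → K y = 0) (x : 𝔼) (r : ℝ) :
    HasDerivAt (fun t : ℝ => ∫ y, v (x + t • y) * K y)
      (∫ y, fderiv ℝ v (x + r • y) y * K y) r := by
  have hK' := hasCompactSupport_of_zero_outside_unitBall hK
  have hfd : Continuous (fderiv ℝ v) := hv.continuous_fderiv one_ne_zero
  have hvc := hv.continuous
  have hcont : Continuous fun p : ℝ × 𝔼 => fderiv ℝ v (x + p.1 • p.2) p.2 * K p.2 := by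
    fun_prop
  obtain ⟨C, hC⟩ := ((isCompact_closedBall r 1).prod
    (isCompact_closedBall (0 : 𝔼) 1)).exists_bound_of_continuousOn hcont.continuousOn
  refine (hasDerivAt_integral_of_dominated_loc_of_deriv_le
    (F := fun (t : ℝ) y => v (x + t • y) * K y)
    (F' := fun (t : ℝ) y => fderiv ℝ v (x + t • y) y * K y)
    (bound := (Metric.closedBall (0 : 𝔼) 1).indicator fun _ => C)
    (Metric.closedBall_mem_nhds r one_pos) ?_ ?_ ?_ ?_ ?_ ?_).2
  · exact .of_forall fun t => Continuous.aestronglyMeasurable (by fun_prop)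
  · exact Continuous.integrable_of_hasCompactSupport (by fun_prop) hK'.mul_left
  · exact Continuous.aestronglyMeasurable (by fun_prop)
  · refine .of_forall fun y t ht => ?_
    by_cases hy : y ∈ Metric.closedBall (0 : 𝔼) 1
    · rw [Set.indicator_of_mem hy]
      exact hC (t, y) ⟨ht, hy⟩
    · rw [Set.indicator_of_notMem hy, hK y (by simpa using (not_le.1 (by simpa using hy)).le)]
      simp
  · exact (integrable_indicator_iff measurableSet_closedBall).2
      (integrableOn_const (measure_closedBall_lt_top).ne)
  · refine .of_forall fun y t _ => ?_
    have h1 : HasDerivAt (fun t : ℝ => x + t • y) y t := by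
      simpa using ((hasDerivAt_id t).smul_const y).const_add x
    exact (((hv.differentiable one_ne_zero _).hasFDerivAt).comp_hasDerivAt t h1).mul_const _

lemma hasFDerivAt_radial {k g : ℝ → ℝ} (hg : ∀ s, HasDerivAt g (k s) s) (y : 𝔼) :
    HasFDerivAt (fun y : 𝔼 => g (‖y‖ ^ 2)) (k (‖y‖ ^ 2) • (2 • innerSL ℝ y)) y :=
  (hg _).comp_hasFDerivAt y (hasStrictFDerivAt_norm_sq y).hasFDerivAt

/-- The radial part of the gradient, averaged against a radial kernel, is an average of the
Laplacian against a primitive of the kernel. -/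
lemma integral_radial_fderiv {v : 𝔼 → ℝ} (hv : ContDiff ℝ 2 v) {k g : ℝ → ℝ}
    (hkc : Continuous k) (hk : ∀ s, 1 ≤ s → k s = 0)
    (hg : ∀ s, HasDerivAt g (k s) s) (hg0 : ∀ s, 1 ≤ s → g s = 0) (x : 𝔼) (r : ℝ) :
    ∫ y, fderiv ℝ v (x + r • y) y * k (‖y‖ ^ 2) =
      -(r / 2) * ∫ y, lap v (x + r • y) * g (‖y‖ ^ 2) := by
  have hk' := hasCompactSupport_of_zero_outside_unitBall
    (radial_zero_outside_unitBall (n := n) hk)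
  have hg' := hasCompactSupport_of_zero_outside_unitBall
    (radial_zero_outside_unitBall (n := n) hg0)
  have hgc : Continuous g := continuous_iff_continuousAt.2 fun s => (hg s).continuousAt
  let e : Fin n → 𝔼 := fun i => EuclideanSpace.single i 1
  let w : Fin n → 𝔼 → ℝ := fun i z => fderiv ℝ v z (e i)
  have hw : ∀ i, ContDiff ℝ 1 (w i) := fun i =>
    (hv.fderiv_right (m := 1) (by norm_num)).clm_apply contDiff_const
  have hwc : ∀ i, Continuous (w i) := fun i => (hw i).continuous
  have hwf : ∀ i, Continuous (fderiv ℝ (w i)) := fun i => (hw i).continuous_fderiv one_ne_zero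
  have hwd : ∀ i y, HasFDerivAt (fun y => w i (x + r • y)) (r • fderiv ℝ (w i) (x + r • y)) y := by
    intro i y
    have h1 : HasFDerivAt (fun y : 𝔼 => x + r • y) (r • ContinuousLinearMap.id ℝ 𝔼) y :=
      ((hasFDerivAt_id y).const_smul r).const_add x
    have h2 := (((hw i).differentiable one_ne_zero (x + r • y)).hasFDerivAt).comp y h1
    convert! h2 using 1
    ext z
    simp
  have hsum : ∀ y z : 𝔼, fderiv ℝ v z y = ∑ i, y i * w i z := by
    intro y z
    have hy : y = ∑ i, y i • e i := by
      simpa [e] using ((EuclideanSpace.basisFun (Fin n) ℝ).sum_repr y).symm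
    conv_lhs => rw [hy]
    simp [w]
  have hint1 : ∀ i, Integrable fun y : 𝔼 => w i (x + r • y) * (y i * k (‖y‖ ^ 2)) := fun i =>
    Continuous.integrable_of_hasCompactSupport (by fun_prop) (hk'.mul_left.mul_left)
  have hint2 : ∀ i, Integrable fun y : 𝔼 => fderiv ℝ (w i) (x + r • y) (e i) * g (‖y‖ ^ 2) :=
    fun i => Continuous.integrable_of_hasCompactSupport (by fun_prop) hg'.mul_left
  have hint3 : ∀ i, Integrable fun y : 𝔼 => w i (x + r • y) * g (‖y‖ ^ 2) := fun i =>
    Continuous.integrable_of_hasCompactSupport (by fun_prop) hg'.mul_left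
  have hparts : ∀ i, ∫ y : 𝔼, w i (x + r • y) * (y i * k (‖y‖ ^ 2)) =
      -(r / 2) * ∫ y, fderiv ℝ (w i) (x + r • y) (e i) * g (‖y‖ ^ 2) := by
    intro i
    have hGe : ∀ y : 𝔼, fderiv ℝ (fun y : 𝔼 => g (‖y‖ ^ 2)) y (e i) =
        2 * (y i * k (‖y‖ ^ 2)) := by
      intro y
      rw [(hasFDerivAt_radial hg y).fderiv]
      simp [e, EuclideanSpace.inner_single_right]
      ring
    have hWe : ∀ y : 𝔼, fderiv ℝ (fun y => w i (x + r • y)) y (e i) =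
        r * fderiv ℝ (w i) (x + r • y) (e i) := by
      intro y
      rw [(hwd i y).fderiv]
      simp
    have h := integral_mul_fderiv_eq_neg_fderiv_mul_of_integrable (μ := (volume : Measure 𝔼))
      (f := fun y => w i (x + r • y)) (g := fun y : 𝔼 => g (‖y‖ ^ 2)) (v := e i)
      (by simpa only [hWe, mul_assoc] using (hint2 i).const_mul r)
      (by simpa only [hGe, mul_left_comm _ (2 : ℝ)] using (hint1 i).const_mul 2)
      (hint3 i) (fun y _ => (hwd i y).differentiableAt)
      (fun y _ => (hasFDerivAt_radial hg y).differentiableAt)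
    simp only [hWe, hGe, mul_assoc, mul_left_comm _ (2 : ℝ), integral_const_mul] at h
    linarith
  calc ∫ y, fderiv ℝ v (x + r • y) y * k (‖y‖ ^ 2)
      = ∫ y, ∑ i, w i (x + r • y) * (y i * k (‖y‖ ^ 2)) := by
        congr 1 with y
        rw [hsum, Finset.sum_mul]
        exact Finset.sum_congr rfl fun i _ => by ring
    _ = ∑ i, -(r / 2) * ∫ y, fderiv ℝ (w i) (x + r • y) (e i) * g (‖y‖ ^ 2) := by
        rw [integral_finsetSum _ fun i _ => hint1 i]
        exact Finset.sum_congr rfl fun i _ => hparts i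
    _ = _ := by
        rw [← Finset.mul_sum, ← integral_finsetSum _ fun i _ => hint2 i]
        simp only [lap, Finset.sum_mul, w, e]

lemma hasDerivAt_radial_average {v : 𝔼 → ℝ} (hv : ContDiff ℝ 2 v) {k g : ℝ → ℝ}
    (hkc : Continuous k) (hk : ∀ s, 1 ≤ s → k s = 0)
    (hg : ∀ s, HasDerivAt g (k s) s) (hg0 : ∀ s, 1 ≤ s → g s = 0) (x : 𝔼) (r : ℝ) :
    HasDerivAt (fun t : ℝ => ∫ y, v (x + t • y) * k (‖y‖ ^ 2))
      (-(r / 2) * ∫ y, lap v (x + r • y) * g (‖y‖ ^ 2)) r := by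
  rw [← integral_radial_fderiv hv hkc hk hg hg0]
  exact hasDerivAt_integral_dilation (hv.of_le (by norm_num)) (by fun_prop)
    (radial_zero_outside_unitBall hk) x r

lemma exists_primitive_zero_right {k : ℝ → ℝ} (hkc : Continuous k) (hk : ∀ s, 1 ≤ s → k s = 0) :
    ∃ g : ℝ → ℝ, (∀ s, HasDerivAt g (k s) s) ∧ ∀ s, 1 ≤ s → g s = 0 := by
  refine ⟨fun s => ∫ t in (1 : ℝ)..s, k t,
    fun s => (hkc.integral_hasStrictDerivAt 1 s).hasDerivAt, fun s hs => ?_⟩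
  refine intervalIntegral.integral_zero_ae (.of_forall fun t ht => hk t ?_)
  rw [Set.uIoc_of_le hs] at ht
  exact ht.1.le

/-- Radial averages of harmonic functions do not depend on the radius. -/
lemma radial_average_of_harmonic {v : 𝔼 → ℝ} (hv : ContDiff ℝ 2 v) (hlap : ∀ x, lap v x = 0)
    {k : ℝ → ℝ} (hkc : Continuous k) (hk : ∀ s, 1 ≤ s → k s = 0) (x : 𝔼) (r : ℝ) :
    ∫ y, v (x + r • y) * k (‖y‖ ^ 2) = v x * ∫ y : 𝔼, k (‖y‖ ^ 2) := by
  obtain ⟨g, hg, hg0⟩ := exists_primitive_zero_right hkc hk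
  have hd := hasDerivAt_radial_average hv hkc hk hg hg0 x
  have h := is_const_of_deriv_eq_zero (fun t => (hd t).differentiableAt)
    (fun t => by rw [(hd t).deriv]; simp [hlap]) r 0
  simpa [integral_const_mul] using h

/-- Pizzetti's formula: radial averages of biharmonic functions are even quadratic polynomials
in the radius. -/
lemma radial_average_of_biharmonic {u : 𝔼 → ℝ} (hu : ContDiff ℝ 2 u) (hlu : ContDiff ℝ 2 (lap u))
    (hlap : ∀ x, lap (lap u) x = 0) {k : ℝ → ℝ} (hkc : Continuous k)
    (hk : ∀ s, 1 ≤ s → k s = 0) (x : 𝔼) :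
    ∃ c : ℝ, ∀ r : ℝ, ∫ y, u (x + r • y) * k (‖y‖ ^ 2) =
      u x * (∫ y : 𝔼, k (‖y‖ ^ 2)) + c * r ^ 2 := by
  obtain ⟨g, hg, hg0⟩ := exists_primitive_zero_right hkc hk
  have hgc : Continuous g := continuous_iff_continuousAt.2 fun s => (hg s).continuousAt
  set a := lap u x * ∫ y : 𝔼, g (‖y‖ ^ 2) with ha
  have hd : ∀ r : ℝ, HasDerivAt
      (fun t : ℝ => (∫ y, u (x + t • y) * k (‖y‖ ^ 2)) - -(a / 4) * t ^ 2) 0 r := by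
    intro r
    have h1 := hasDerivAt_radial_average hu hkc hk hg hg0 x r
    rw [radial_average_of_harmonic hlu hlap hgc hg0, ← ha] at h1
    convert! h1.sub (((hasDerivAt_id r).pow 2).const_mul (-(a / 4))) using 1
    simp
    ring
  refine ⟨-(a / 4), fun r => ?_⟩
  have h := is_const_of_deriv_eq_zero (fun t => (hd t).differentiableAt)
    (fun t => (hd t).deriv) r 0
  simp [integral_const_mul] at h
  linarith

end RadialKernel

lemma contDiff_lap {n : ℕ} {u : EuclideanSpace ℝ (Fin n) → ℝ} (hu : ContDiff ℝ (⊤ : ℕ∞) u) :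
    ContDiff ℝ (⊤ : ℕ∞) (lap u) := by
  have hD : ∀ {w : EuclideanSpace ℝ (Fin n) → ℝ} (e : EuclideanSpace ℝ (Fin n)),
      ContDiff ℝ (⊤ : ℕ∞) w → ContDiff ℝ (⊤ : ℕ∞) fun y => fderiv ℝ w y e := fun e hw =>
    (hw.fderiv_right (m := (⊤ : ℕ∞)) (by simp)).clm_apply contDiff_const
  exact ContDiff.sum fun i _ => hD _ (hD _ hu)

/-- Averages of a function of sublinear growth against a dilated cone kernel become independent
of the centre. -/
lemma tendsto_cone_average_sub {n : ℕ} {d C : ℝ} (hd0 : 0 ≤ d) (hd1 : d < 1)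
    {u : EuclideanSpace ℝ (Fin n) → ℝ} (hu : Continuous u) (hC : 0 < C)
    (hgrow : ∀ x, |u x| ≤ C * (1 + ‖x‖ ^ d)) (x : EuclideanSpace ℝ (Fin n)) :
    Tendsto (fun r : ℝ => (∫ y, u (x + r • y) * max 0 (1 - ‖y‖)) -
      ∫ y, u (0 + r • y) * max 0 (1 - ‖y‖)) atTop (𝓝 0) := by
  set V := (volume : Measure (EuclideanSpace ℝ (Fin n))).real (Metric.closedBall 0 2)
  have hlim : Tendsto (fun r : ℝ => C * (r⁻¹ + 2 ^ d * r ^ (-(1 - d))) * ‖x‖ * V)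
      atTop (𝓝 0) := by
    simpa using (((tendsto_inv_atTop_zero.add
      ((tendsto_rpow_neg_atTop (sub_pos.2 hd1)).const_mul (2 ^ d))).const_mul C).mul_const
        ‖x‖).mul_const V
  refine squeeze_zero_norm' ?_ hlim
  filter_upwards [eventually_ge_atTop (max 1 ‖x‖)] with r hr
  have hr1 : 1 ≤ r := (le_max_left _ _).trans hr
  have hrx : ‖x‖ ≤ r := (le_max_right _ _).trans hr
  have hr0 : 0 < r := one_pos.trans_le hr1
  set z := r⁻¹ • x
  have hz : ‖z‖ = r⁻¹ * ‖x‖ := by simp [z, norm_smul, abs_of_pos hr0]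
  have hz1 : ‖z‖ ≤ 1 := by
    rw [hz, inv_mul_le_iff₀ hr0]
    simpa using hrx
  have hcone : HasCompactSupport fun y : EuclideanSpace ℝ (Fin n) => max 0 (1 - ‖y‖) :=
    hasCompactSupport_of_zero_outside_unitBall fun y hy => max_eq_left (by linarith)
  have hshift : ∫ y, u (x + r • y) * max 0 (1 - ‖y‖) =
      ∫ y, u (0 + r • y) * max 0 (1 - ‖y - z‖) := by
    rw [← integral_sub_right_eq_self (fun y => u (x + r • y) * max 0 (1 - ‖y‖)) z]
    congr 1 with y
    congr 2
    simp [z, smul_sub, smul_smul, hr0.ne']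
  have hi1 : Integrable fun y => u (0 + r • y) * max 0 (1 - ‖y - z‖) :=
    Continuous.integrable_of_hasCompactSupport (by fun_prop)
      (hcone.comp_homeomorph (Homeomorph.subRight z)).mul_left
  have hi2 : Integrable fun y => u (0 + r • y) * max 0 (1 - ‖y‖) :=
    Continuous.integrable_of_hasCompactSupport (by fun_prop) hcone.mul_left
  rw [hshift, ← integral_sub hi1 hi2, ← setIntegral_eq_integral_of_forall_compl_eq_zero
    (s := Metric.closedBall 0 2)]
  · refine (norm_setIntegral_le_of_norm_le_const (C := C * (1 + (2 * r) ^ d) * ‖z‖)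
      measure_closedBall_lt_top fun y hy => ?_).trans_eq ?_
    · have hy2 : ‖y‖ ≤ 2 := by simpa using hy
      rw [← mul_sub, norm_mul]
      have h1 : ‖u (0 + r • y)‖ ≤ C * (1 + (2 * r) ^ d) := by
        refine (hgrow _).trans ?_
        gcongr
        rw [zero_add, norm_smul, Real.norm_of_nonneg hr0.le, mul_comm]
        gcongr
      have h2 : ‖max 0 (1 - ‖y - z‖) - max 0 (1 - ‖y‖)‖ ≤ ‖z‖ := by
        rw [Real.norm_eq_abs]
        calc |max 0 (1 - ‖y - z‖) - max 0 (1 - ‖y‖)|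
            ≤ |(1 - ‖y - z‖) - (1 - ‖y‖)| := by
              simpa using abs_max_sub_max_le_max 0 (1 - ‖y - z‖) 0 (1 - ‖y‖)
          _ = |‖y‖ - ‖y - z‖| := by ring_nf
          _ ≤ ‖y - (y - z)‖ := abs_norm_sub_norm_le _ _
          _ = ‖z‖ := by simp
      exact mul_le_mul h1 h2 (norm_nonneg _) (by positivity)
    · rw [hz, Real.mul_rpow two_pos.le hr0.le, neg_sub, Real.rpow_sub hr0, Real.rpow_one]
      field_simp
      rfl
  · intro y hy
    have hy2 : 2 < ‖y‖ := by simpa using hy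
    have h3 := norm_sub_norm_le y z
    rw [max_eq_left (by linarith), max_eq_left (by linarith)]
    simp

/-- For 0 ≤ d < 1, biharmonic functions on ℝⁿ with polynomial growth of rate d are exactly
the constant functions. -/
theorem H2_subunit_growth_eq_constants {n : ℕ} (d : ℝ) (hd0 : 0 ≤ d) (hd1 : d < 1)
    (u : EuclideanSpace ℝ (Fin n) → ℝ) :
    (ContDiff ℝ (⊤ : ℕ∞) u ∧ (∀ x, lap (lap u) x = 0) ∧
        ∃ Cu : ℝ, 0 < Cu ∧ ∀ x, |u x| ≤ Cu * (1 + ‖x‖ ^ d)) ↔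
      ∃ c : ℝ, ∀ x, u x = c := by
  constructor
  · rintro ⟨hu, hlap, C, hC, hgrow⟩
    refine ⟨u 0, fun x => ?_⟩
    have hkc : Continuous fun s : ℝ => max 0 (1 - √s) := by fun_prop
    have hk : ∀ s : ℝ, 1 ≤ s → max 0 (1 - √s) = 0 := fun s hs =>
      max_eq_left (by linarith [Real.one_le_sqrt.2 hs])
    have hA : 0 < ∫ y : EuclideanSpace ℝ (Fin n), max 0 (1 - ‖y‖) :=
      Continuous.integral_pos_of_hasCompactSupport_nonneg_nonzero (x := 0) (by fun_prop)
        (hasCompactSupport_of_zero_outside_unitBall fun y hy => max_eq_left (by linarith))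
        (fun y => le_max_left _ _) (by simp)
    have hpiz := radial_average_of_biharmonic (hu.of_le (WithTop.coe_le_coe.2 (le_top : (2 : ℕ∞) ≤ ⊤)))
      ((contDiff_lap hu).of_le (WithTop.coe_le_coe.2 (le_top : (2 : ℕ∞) ≤ ⊤))) hlap hkc hk
    simp only [Real.sqrt_sq (norm_nonneg _)] at hpiz
    obtain ⟨c, hc⟩ := hpiz x
    obtain ⟨c', hc'⟩ := hpiz 0
    have hlim := tendsto_cone_average_sub hd0 hd1 hu.continuous hC hgrow x
    have hlim2 := (hlim.const_mul 4).sub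
      (hlim.comp (tendsto_id.const_mul_atTop (two_pos : (0 : ℝ) < 2)))
    have hconst := hlim2.congr (f₂ := fun _ =>
      3 * ((u x - u 0) * ∫ y : EuclideanSpace ℝ (Fin n), max 0 (1 - ‖y‖))) fun r => by
        simp only [Function.comp, id, hc, hc']
        ring
    have h0 := tendsto_nhds_unique hconst tendsto_const_nhds
    have h1 : u x - u 0 = 0 := by
      simpa [hA.ne'] using h0.symm
    linarith
  · rintro ⟨c, hc⟩
    obtain rfl : u = fun _ => c := funext hc
    have hlap : ∀ b : ℝ, lap (fun _ : EuclideanSpace ℝ (Fin n) => b) = fun _ => 0 := fun b => by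
      ext x
      simp [lap]
    refine ⟨contDiff_const, fun x => by simp [hlap], |c| + 1, by positivity, fun x => ?_⟩
    have : 0 ≤ ‖x‖ ^ d := by positivity
    nlinarith [abs_nonneg c]
end
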